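/- Let A be a C*-algebra, Ω a compact subset of ℂ, and let φ, ψ, γ : C(Ω, ℂ) → A be *-homomorphisms. Then d_W(φ, ψ) ≤ d_W(φ, γ) + d_W(γ, ψ), where the inequality and addition are taken in [0, ∞]. -/

import Mathlib

open Filter Topology
open scoped ENNReal

/-- Cuntz subequivalence of elements of a C*-algebra: `a ≾ b` iff there is a sequence `rₙ`
with `‖rₙ* b rₙ - a‖ → 0`. -/
def CuntzLE {A : Type*} [NonUnitalNormedRing A] [StarRing A] (a b : A) : Prop :=
  ∃ r : ℕ → A, Tendsto (fun n => ‖star (r n) * b * r n - a‖) atTop (nhds 0)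

/-- `O` is a relatively open subset of `Ω`. -/
def RelOpen (Ω O : Set ℂ) : Prop := ∃ U : Set ℂ, IsOpen U ∧ O = U ∩ Ω

/-- The function `f_O : ℂ → ℂ`, equal to `min 1 (dist z (Ω \ O))` (with the convention that the
distance to the empty set is `∞`); its restriction to `Ω` is supported exactly on `O`. -/
noncomputable def fOFun (Ω O : Set ℂ) : ℂ → ℂ :=
  fun z => (((min 1 (EMetric.infEdist z (Ω \ O))).toReal : ℝ) : ℂ)

lemma continuous_fOFun (Ω O : Set ℂ) : Continuous (fOFun Ω O) := by
  apply Complex.continuous_ofReal.comp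
  apply ENNReal.continuousOn_toReal.comp_continuous
    (continuous_const.min EMetric.continuous_infEdist)
  intro z
  exact ne_top_of_le_ne_top ENNReal.one_ne_top (min_le_left _ _)

/-- `f_O` as an element of `C(Ω, ℂ)`. -/
noncomputable def fO (Ω O : Set ℂ) : C(Ω, ℂ) :=
  ⟨fun z => fOFun Ω O z, (continuous_fOFun Ω O).comp continuous_subtype_val⟩

/-- `O_r = {x ∈ Ω | dist (x, O) < r}`. -/
def thicken (Ω O : Set ℂ) (r : ℝ) : Set ℂ := {x | x ∈ Ω ∧ Metric.infDist x O < r}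

/-- The Cuntz distance `d_W` between two maps `C(Ω, ℂ) → A`, with values in `[0, ∞]`
(the infimum of the empty set being `∞`). -/
noncomputable def dW {A : Type*} [NonUnitalNormedRing A] [StarRing A]
    (Ω : Set ℂ) (φ ψ : C(Ω, ℂ) → A) : ℝ≥0∞ :=
  sInf {e : ℝ≥0∞ | ∃ r : ℝ, 0 < r ∧ e = ENNReal.ofReal r ∧
    ∀ O : Set ℂ, RelOpen Ω O →
      CuntzLE (φ (fO Ω O)) (ψ (fO Ω (thicken Ω O r))) ∧
      CuntzLE (ψ (fO Ω O)) (φ (fO Ω (thicken Ω O r)))}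

/-- Cuntz subequivalence can be tested one `ε` at a time. -/
lemma cuntzLE_iff_forall_pos {A : Type*} [NonUnitalNormedRing A] [StarRing A] {a b : A} :
    CuntzLE a b ↔ ∀ ε > 0, ∃ r : A, ‖star r * b * r - a‖ < ε := by
  constructor
  · rintro ⟨r, hr⟩ ε hε
    obtain ⟨n, hn⟩ := (hr.eventually_lt_const hε).exists
    exact ⟨r n, hn⟩
  · intro h
    choose r hr using fun n : ℕ => h (1 / ((n : ℝ) + 1)) (by positivity)
    exact ⟨r, squeeze_zero (fun _ => norm_nonneg _) (fun n => (hr n).le)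
      tendsto_one_div_add_atTop_nhds_zero_nat⟩

/-- Cuntz subequivalence is transitive. -/
lemma CuntzLE.trans {A : Type*} [NonUnitalNormedRing A] [StarRing A] {a b c : A}
    (hab : CuntzLE a b) (hbc : CuntzLE b c) : CuntzLE a c := by
  rw [cuntzLE_iff_forall_pos] at *
  intro ε hε
  obtain ⟨r, hr⟩ := hab (ε / 2) (half_pos hε)
  have hK : 0 < ‖star r‖ * ‖r‖ + 1 := by positivity
  obtain ⟨s, hs⟩ := hbc (ε / 2 / (‖star r‖ * ‖r‖ + 1)) (by positivity)
  rw [lt_div_iff₀ hK] at hs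
  refine ⟨s * r, ?_⟩
  have key : star (s * r) * c * (s * r) - a =
      star r * (star s * c * s - b) * r + (star r * b * r - a) := by
    simp only [star_mul, mul_sub, sub_mul, mul_assoc]
    abel
  have h₁ : ‖star r * (star s * c * s - b) * r‖ ≤ ‖star r‖ * ‖star s * c * s - b‖ * ‖r‖ :=
    norm_mul₃_le
  rw [key]
  refine (norm_add_le _ _).trans_lt ?_
  nlinarith [norm_nonneg (star s * c * s - b)]

/-- *-homomorphisms of C*-algebras preserve Cuntz subequivalence. -/
lemma CuntzLE.map {A B : Type*} [NonUnitalCStarAlgebra A] [NonUnitalCStarAlgebra B]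
    (φ : A →⋆ₙₐ[ℂ] B) {a b : A} (h : CuntzLE a b) : CuntzLE (φ a) (φ b) := by
  obtain ⟨r, hr⟩ := h
  refine ⟨fun n => φ (r n), squeeze_zero (fun _ => norm_nonneg _) (fun n => ?_) hr⟩
  rw [← map_star, ← map_mul, ← map_mul, ← map_sub]
  exact NonUnitalStarAlgHom.norm_apply_le φ _

/-- Pointwise domination of nonnegative functions implies Cuntz subequivalence. -/
lemma cuntzLE_of_le {X : Type*} [TopologicalSpace X] [CompactSpace X] (F G : C(X, ℂ))
    {f g : X → ℝ} (hF : ∀ x, F x = f x) (hG : ∀ x, G x = g x)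
    (hf : ∀ x, 0 ≤ f x) (hfg : ∀ x, f x ≤ g x) : CuntzLE F G := by
  have hfc : Continuous f := (Complex.continuous_re.comp F.continuous).congr fun x => by simp [hF]
  have hgc : Continuous g := (Complex.continuous_re.comp G.continuous).congr fun x => by simp [hG]
  rw [cuntzLE_iff_forall_pos]
  intro ε hε
  have hpos : ∀ x, 0 < g x + ε / 2 := fun x => by linarith [hf x, hfg x]
  refine ⟨⟨fun x => ((√(f x / (g x + ε / 2)) : ℝ) : ℂ), Complex.continuous_ofReal.comp
    (hfc.div (hgc.add continuous_const) fun x => (hpos x).ne').sqrt⟩, ?_⟩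
  refine ((ContinuousMap.norm_le _ (half_pos hε).le).2 fun x => ?_).trans_lt (half_lt_self hε)
  have hsq : √(f x / (g x + ε / 2)) * √(f x / (g x + ε / 2)) = f x / (g x + ε / 2) :=
    Real.mul_self_sqrt (div_nonneg (hf x) (hpos x).le)
  have heq : √(f x / (g x + ε / 2)) * g x * √(f x / (g x + ε / 2)) - f x =
      -(f x * (ε / 2) / (g x + ε / 2)) := by
    rw [mul_right_comm, hsq, div_mul_eq_mul_div, sub_eq_iff_eq_add, ← sub_eq_neg_add,
      eq_sub_iff_add_eq, ← add_div, ← mul_add, mul_div_cancel_right₀ _ (hpos x).ne']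
  simp only [ContinuousMap.sub_apply, ContinuousMap.mul_apply, ContinuousMap.star_apply,
    ContinuousMap.coe_mk, hF, hG, RCLike.star_def, Complex.conj_ofReal]
  rw [← Complex.ofReal_mul, ← Complex.ofReal_mul, ← Complex.ofReal_sub, Complex.norm_real, heq,
    norm_neg, Real.norm_of_nonneg (div_nonneg (mul_nonneg (hf x) (half_pos hε).le) (hpos x).le),
    div_le_iff₀ (hpos x)]
  nlinarith [hfg x]

/-- The functions `f_O` are monotone in `O` for Cuntz subequivalence. -/
lemma cuntzLE_fO_of_subset {Ω O O' : Set ℂ} [CompactSpace Ω] (h : O ⊆ O') :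
    CuntzLE (fO Ω O) (fO Ω O') := by
  refine cuntzLE_of_le _ _ (fun _ => rfl) (fun _ => rfl) (fun _ => ENNReal.toReal_nonneg)
    fun x => ENNReal.toReal_mono ?_ ?_
  · exact ne_top_of_le_ne_top ENNReal.one_ne_top (min_le_left _ _)
  · exact min_le_min_left _ (Metric.infEDist_anti (Set.sdiff_subset_sdiff_right h))

lemma relOpen_thicken (Ω O : Set ℂ) (r : ℝ) : RelOpen Ω (thicken Ω O r) :=
  ⟨{x | Metric.infDist x O < r},
    isOpen_lt (Metric.continuous_infDist_pt O) continuous_const, Set.inter_comm _ _⟩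

/-- Iterated thickenings are contained in the thickening by the sum of the radii. -/
lemma thicken_thicken_subset {Ω O : Set ℂ} (hO : O ⊆ Ω) {r s : ℝ} (hr : 0 < r) (hs : 0 < s) :
    thicken Ω (thicken Ω O r) s ⊆ thicken Ω O (r + s) := by
  rintro x ⟨hx, hxs⟩
  refine ⟨hx, ?_⟩
  rcases O.eq_empty_or_nonempty with rfl | ⟨y, hy⟩
  · simpa using add_pos hr hs
  have hne : (thicken Ω O r).Nonempty :=
    ⟨y, hO hy, by rwa [Metric.infDist_zero_of_mem hy]⟩
  obtain ⟨z, hz, hxz⟩ := (Metric.infDist_lt_iff hne).1 hxs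
  linarith [hz.2, Metric.infDist_le_infDist_add_dist (s := O) (x := x) (y := z)]

/-- Cuntz comparisons up to thickening compose, with the radii adding up. -/
lemma cuntzLE_thicken_add {A : Type*} [NonUnitalCStarAlgebra A] {Ω : Set ℂ} [CompactSpace Ω]
    {φ ψ γ : C(Ω, ℂ) →⋆ₙₐ[ℂ] A} {r s : ℝ} (hr : 0 < r) (hs : 0 < s)
    (hφγ : ∀ O, RelOpen Ω O → CuntzLE (φ (fO Ω O)) (γ (fO Ω (thicken Ω O r))))
    (hγψ : ∀ O, RelOpen Ω O → CuntzLE (γ (fO Ω O)) (ψ (fO Ω (thicken Ω O s))))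
    {O : Set ℂ} (hO : RelOpen Ω O) :
    CuntzLE (φ (fO Ω O)) (ψ (fO Ω (thicken Ω O (r + s)))) := by
  have hOΩ : O ⊆ Ω := by
    obtain ⟨U, -, rfl⟩ := hO
    exact Set.inter_subset_right
  exact ((hφγ O hO).trans (hγψ _ (relOpen_thicken Ω O r))).trans
    ((cuntzLE_fO_of_subset (thicken_thicken_subset hOΩ hr hs)).map ψ)

/-- Let `A` be a C*-algebra, `Ω` a compact subset of `ℂ`, and `φ, ψ, γ : C(Ω, ℂ) → A`
*-homomorphisms.  Then `d_W(φ, ψ) ≤ d_W(φ, γ) + d_W(γ, ψ)` in `[0, ∞]`. -/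
theorem statement10 {A : Type*} [NonUnitalCStarAlgebra A]
    (Ω : Set ℂ) (hΩ : IsCompact Ω)
    (φ ψ γ : C(Ω, ℂ) →⋆ₙₐ[ℂ] A) :
    dW Ω ⇑φ ⇑ψ ≤ dW Ω ⇑φ ⇑γ + dW Ω ⇑γ ⇑ψ := by
  have : CompactSpace Ω := isCompact_iff_compactSpace.1 hΩ
  unfold dW
  rw [ENNReal.sInf_add]
  refine le_iInf₂ ?_
  rintro _ ⟨r, hr, rfl, h₁⟩
  rw [add_comm, ENNReal.sInf_add]
  refine le_iInf₂ ?_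
  rintro _ ⟨s, hs, rfl, h₂⟩
  refine sInf_le ⟨r + s, add_pos hr hs, ?_, fun O hO => ⟨?_, ?_⟩⟩
  · rw [add_comm, ENNReal.ofReal_add hr.le hs.le]
  · exact cuntzLE_thicken_add hr hs (fun O hO => (h₁ O hO).1) (fun O hO => (h₂ O hO).1) hO
  · rw [add_comm r s]
    exact cuntzLE_thicken_add hs hr (fun O hO => (h₂ O hO).2) (fun O hO => (h₁ O hO).2) hO
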